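/- arXiv:2310.10182 — 3 statements merged into one kernel-verified Lean document; each statement's English description precedes it below -/
import Mathlib

section
/- Let A, B ∈ Sym(H) ∩ HS(H). Then the trace-class operators A²B² and ABAB satisfy tr(ABAB) ≤ tr(A²B²), i.e., tr(A²B² − (AB)²) ≥ 0, and also (tr(AB))² ≤ tr(A²)·tr(B²). Consequently, the sectional curvature of the manifold Tr(H,C₀) with the Fisher-Rao metric, given at P by S_P(X_P,Y_P) = − tr(Ã²B̃² − (ÃB̃)²) / (tr(Ã²)tr(B̃²) − (tr(ÃB̃))²) for linearly independent tangent vectors X_P = P^{1/2}ÃP^{1/2}, Y_P = P^{1/2}B̃P^{1/2} with Ã, B̃ ∈ Sym(H) ∩ HS(H), is everywhere nonpositive. -/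
open scoped RealInnerProductSpace
open ContinuousLinearMap

noncomputable section

variable {H : Type*} [NormedAddCommGroup H] [InnerProductSpace ℝ H] [CompleteSpace H]

/-- `A` is positive definite: self-adjoint and `⟪x, A x⟫ ≥ M‖x‖²` for some `M > 0`. -/
def IsPosDef (A : H →L[ℝ] H) : Prop :=
  IsSelfAdjoint A ∧ ∃ M : ℝ, 0 < M ∧ ∀ x : H, M * ‖x‖ ^ 2 ≤ ⟪x, A x⟫

/-- `A` is Hilbert-Schmidt (with respect to the Hilbert basis `e`; this is
basis-independent). -/
def IsHS (e : HilbertBasis ℕ ℝ H) (A : H →L[ℝ] H) : Prop :=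
  Summable fun n => ‖A (e n)‖ ^ 2

/-- The trace of `A` computed along the Hilbert basis `e` (basis-independent for
trace-class operators). -/
def traceAlong (e : HilbertBasis ℕ ℝ H) (A : H →L[ℝ] H) : ℝ :=
  ∑' n, ⟪e n, A (e n)⟫

theorem IsHS.mul_left {e : HilbertBasis ℕ ℝ H} {X : H →L[ℝ] H} (hX : IsHS e X)
    (T : H →L[ℝ] H) : IsHS e (T * X) := by
  refine Summable.of_nonneg_of_le (fun n => by positivity) (fun n => ?_)
    (Summable.mul_left (‖T‖ ^ 2) hX)
  rw [← mul_pow]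
  exact pow_le_pow_left₀ (norm_nonneg _) (T.le_opNorm _) 2

/-- The coefficients of a Hilbert-Schmidt operator are square-summable. -/
theorem IsHS.summable_sq_inner {e : HilbertBasis ℕ ℝ H} {X : H →L[ℝ] H} (hX : IsHS e X) :
    Summable fun p : ℕ × ℕ => ⟪X (e p.1), e p.2⟫ ^ 2 := by
  have h (n : ℕ) : HasSum (fun m => ⟪X (e n), e m⟫ ^ 2) (‖X (e n)‖ ^ 2) := by
    rw [← real_inner_self_eq_norm_sq]
    refine (e.hasSum_inner_mul_inner (X (e n)) (X (e n))).congr_fun fun m => ?_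
    rw [sq, real_inner_comm (X (e n)) (e m)]
  refine (summable_prod_of_nonneg fun p => sq_nonneg _).2 ⟨fun n => (h n).summable, ?_⟩
  exact hX.congr fun n => ((h n).tsum_eq).symm

/-- The Hilbert-Schmidt inner product is a convergent sum. -/
theorem IsHS.summable_inner {e : HilbertBasis ℕ ℝ H} {X Y : H →L[ℝ] H} (hX : IsHS e X)
    (hY : IsHS e Y) : Summable fun n => ⟪X (e n), Y (e n)⟫ := by
  refine Summable.of_norm_bounded (Summable.add hX hY) fun n => ?_
  have h := norm_inner_le_norm (𝕜 := ℝ) (X (e n)) (Y (e n))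
  nlinarith [sq_nonneg (‖X (e n)‖ - ‖Y (e n)‖), sq_nonneg ‖X (e n)‖, sq_nonneg ‖Y (e n)‖]

/-- The Hilbert-Schmidt inner product is invariant under taking adjoints. -/
theorem IsHS.tsum_inner_adjoint {e : HilbertBasis ℕ ℝ H} {X Y : H →L[ℝ] H} (hX : IsHS e X)
    (hY : IsHS e Y) :
    ∑' n, ⟪X (e n), Y (e n)⟫ = ∑' n, ⟪adjoint Y (e n), adjoint X (e n)⟫ := by
  have hs : Summable fun p : ℕ × ℕ => ⟪X (e p.1), e p.2⟫ * ⟪e p.2, Y (e p.1)⟫ := by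
    refine Summable.of_norm_bounded (hX.summable_sq_inner.add hY.summable_sq_inner) fun p => ?_
    rw [real_inner_comm (Y (e p.1)) (e p.2), Real.norm_eq_abs, abs_le]
    constructor <;>
      nlinarith [sq_nonneg (⟪X (e p.1), e p.2⟫ + ⟪Y (e p.1), e p.2⟫),
        sq_nonneg (⟪X (e p.1), e p.2⟫ - ⟪Y (e p.1), e p.2⟫),
        sq_nonneg ⟪X (e p.1), e p.2⟫, sq_nonneg ⟪Y (e p.1), e p.2⟫]
  calc ∑' n, ⟪X (e n), Y (e n)⟫
      = ∑' n, ∑' m, ⟪X (e n), e m⟫ * ⟪e m, Y (e n)⟫ := by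
        simp_rw [e.tsum_inner_mul_inner]
    _ = ∑' m, ∑' n, ⟪X (e n), e m⟫ * ⟪e m, Y (e n)⟫ := hs.prod_symm.tsum_comm
    _ = ∑' m, ∑' n, ⟪adjoint Y (e m), e n⟫ * ⟪e n, adjoint X (e m)⟫ := by
        simp_rw [adjoint_inner_left, adjoint_inner_right, mul_comm]
    _ = ∑' m, ⟪adjoint Y (e m), adjoint X (e m)⟫ := by
        simp_rw [e.tsum_inner_mul_inner]

/-- The Cauchy-Schwarz inequality for the Hilbert-Schmidt inner product. -/
theorem IsHS.sq_tsum_inner_le {e : HilbertBasis ℕ ℝ H} {X Y : H →L[ℝ] H} (hX : IsHS e X)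
    (hY : IsHS e Y) :
    (∑' n, ⟪X (e n), Y (e n)⟫) ^ 2 ≤
      (∑' n, ⟪X (e n), X (e n)⟫) * ∑' n, ⟪Y (e n), Y (e n)⟫ := by
  have h := discrim_le_zero (a := ∑' n, ⟪X (e n), X (e n)⟫)
    (b := 2 * ∑' n, ⟪X (e n), Y (e n)⟫) (c := ∑' n, ⟪Y (e n), Y (e n)⟫) fun t => by
      have hsum := (((hX.summable_inner hX).hasSum.mul_right (t * t)).add
        (((hX.summable_inner hY).hasSum.mul_left 2).mul_right t)).add
        (hY.summable_inner hY).hasSum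
      refine hsum.nonneg fun n => ?_
      have h0 : 0 ≤ ⟪t • X (e n) + Y (e n), t • X (e n) + Y (e n)⟫ := real_inner_self_nonneg
      simp only [inner_add_left, inner_add_right, real_inner_smul_left,
        real_inner_smul_right, real_inner_comm (X (e n)) (Y (e n))] at h0
      linarith
  rw [discrim] at h
  linarith

/-- for self-adjoint Hilbert-Schmidt `A, B` the products `A²B²` and
`ABAB` are trace class with `tr(ABAB) ≤ tr(A²B²)` and `(tr AB)² ≤ tr(A²) tr(B²)`;
consequently the sectional curvature of `Tr(H,C₀)` under the Fisher-Rao metric,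
`S_P(X,Y) = - tr(A²B² - (AB)²) / (tr A² tr B² - (tr AB)²)` for linearly
independent tangent directions, is nonpositive. -/
theorem sectional_curvature_nonpos
    (e : HilbertBasis ℕ ℝ H)
    (A B : H →L[ℝ] H)
    (hAsa : IsSelfAdjoint A) (hAHS : IsHS e A)
    (hBsa : IsSelfAdjoint B) (hBHS : IsHS e B) :
    (Summable fun n => ⟪e n, (A * B * A * B) (e n)⟫) ∧
    (Summable fun n => ⟪e n, (A * A * B * B) (e n)⟫) ∧
    traceAlong e (A * B * A * B) ≤ traceAlong e (A * A * B * B) ∧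
    traceAlong e (A * B) ^ 2 ≤ traceAlong e (A * A) * traceAlong e (B * B) ∧
    (LinearIndependent ℝ ![A, B] →
      -((traceAlong e (A * A * B * B) - traceAlong e (A * B * A * B)) /
          (traceAlong e (A * A) * traceAlong e (B * B) - traceAlong e (A * B) ^ 2)) ≤ 0) := by
  have hA (x y : H) : ⟪A x, y⟫ = ⟪x, A y⟫ := hAsa.isSymmetric x y
  have hB (x y : H) : ⟪B x, y⟫ = ⟪x, B y⟫ := hBsa.isSymmetric x y
  have adjA : adjoint A = A := hAsa.adjoint_eq
  have adjB : adjoint B = B := hBsa.adjoint_eq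
  have hAB : IsHS e (A * B) := hBHS.mul_left A
  have hBA : IsHS e (B * A) := hAHS.mul_left B
  have hBAA : IsHS e (B * A * A) := hAHS.mul_left (B * A)
  have eq_abab (n : ℕ) :
      ⟪e n, (A * B * A * B) (e n)⟫ = ⟪(B * A) (e n), (A * B) (e n)⟫ := by
    simp [hA, hB]
  have eq_aabb (n : ℕ) :
      ⟪e n, (A * A * B * B) (e n)⟫ = ⟪(B * A * A) (e n), B (e n)⟫ := by
    simp [hA, hB]
  have tr_mul {X Y : H →L[ℝ] H} (hX : ∀ x y : H, ⟪X x, y⟫ = ⟪x, X y⟫) :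
      traceAlong e (X * Y) = ∑' n, ⟪X (e n), Y (e n)⟫ := by
    simp [traceAlong, hX]
  have norm_swap : ∑' n, ⟪(A * B) (e n), (A * B) (e n)⟫ =
      ∑' n, ⟪(B * A) (e n), (B * A) (e n)⟫ := by
    rw [hAB.tsum_inner_adjoint hAB]
    simp only [mul_def, adjoint_comp, adjA, adjB]
  have tr_aabb : traceAlong e (A * A * B * B) =
      ∑' n, ⟪(A * B) (e n), (A * B) (e n)⟫ := by
    rw [traceAlong, tsum_congr eq_aabb, hBAA.tsum_inner_adjoint hBHS]
    simp only [mul_def, adjoint_comp, adjA, adjB, coe_comp, Function.comp_apply, hA]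
  have curv : traceAlong e (A * B * A * B) ≤ traceAlong e (A * A * B * B) := by
    have h := ((hAB.summable_inner hAB).hasSum.add (hBA.summable_inner hBA).hasSum).sub
      ((hBA.summable_inner hAB).hasSum.mul_left 2) |>.nonneg fun n => by
        have h0 := real_inner_self_nonneg (x := (A * B) (e n) - (B * A) (e n))
        rw [real_inner_sub_sub_self, real_inner_comm ((B * A) (e n))] at h0
        linarith
    rw [tr_aabb, traceAlong, tsum_congr eq_abab]
    linarith
  have cs : traceAlong e (A * B) ^ 2 ≤ traceAlong e (A * A) * traceAlong e (B * B) := by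
    rw [tr_mul hA, tr_mul hA, tr_mul hB]
    exact hAHS.sq_tsum_inner_le hBHS
  refine ⟨(hBA.summable_inner hAB).congr fun n => (eq_abab n).symm,
    (hBAA.summable_inner hBHS).congr fun n => (eq_aabb n).symm, curv, cs, fun _ => ?_⟩
  exact neg_nonpos.2 (div_nonneg (sub_nonneg.2 curv) (sub_nonneg.2 cs))
end
end

section
/- Let a, b be elements of a real inner product space. Then (‖a‖² − ‖b‖²)² ≤ ‖a‖⁴ + ‖b‖⁴ − 2⟨a,b⟩² ≤ ‖a−b‖²·(‖a‖ + ‖b‖)². -/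
open scoped RealInnerProductSpace

/-- for elements `a, b` of a real inner product space,
`(‖a‖² - ‖b‖²)² ≤ ‖a‖⁴ + ‖b‖⁴ - 2⟪a,b⟫² ≤ ‖a-b‖²(‖a‖+‖b‖)²`. -/
theorem norm_fourth_power_inner_bounds
    {E : Type*} [NormedAddCommGroup E] [InnerProductSpace ℝ E] (a b : E) :
    (‖a‖ ^ 2 - ‖b‖ ^ 2) ^ 2 ≤ ‖a‖ ^ 4 + ‖b‖ ^ 4 - 2 * ⟪a, b⟫ ^ 2 ∧
      ‖a‖ ^ 4 + ‖b‖ ^ 4 - 2 * ⟪a, b⟫ ^ 2 ≤ ‖a - b‖ ^ 2 * (‖a‖ + ‖b‖) ^ 2 := by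
  have h_upper : ⟪a, b⟫ ≤ ‖a‖ * ‖b‖ := real_inner_le_norm a b
  have h_sq : ⟪a, b⟫ ^ 2 ≤ (‖a‖ * ‖b‖) ^ 2 :=
    sq_le_sq.mpr ((abs_real_inner_le_norm a b).trans (le_abs_self _))
  refine ⟨by linarith, ?_⟩
  have h_nonneg : 0 ≤ (‖a‖ * ‖b‖ - ⟪a, b⟫) * (‖a‖ ^ 2 + ‖b‖ ^ 2 + (‖a‖ * ‖b‖ - ⟪a, b⟫)) := by
    have := sub_nonneg.mpr h_upper
    positivity
  rw [norm_sub_sq_real]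
  linarith
end

section
/- Let H be a real separable Hilbert space, m ∈ H, and C a self-adjoint positive trace-class operator on H; let N(m,C) be the Gaussian measure on H with mean m and covariance operator C. Then for all bounded operators A, B ∈ L(H): ∫_H ⟨x−m, A(x−m)⟩·⟨x−m, B(x−m)⟩ dN(m,C)(x) = tr(CA)·tr(CB) + (1/2)·tr(C(A+A*)C(B+B*)). If A and B are self-adjoint, this equals tr(CA)·tr(CB) + 2·tr(CACB); in particular, for self-adjoint A, ∫_H ⟨x−m, A(x−m)⟩² dN(m,C)(x) = (tr(CA))² + 2·tr((CA)²). -/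
open scoped RealInnerProductSpace
open ContinuousLinearMap

noncomputable section

variable {H : Type*} [NormedAddCommGroup H] [InnerProductSpace ℝ H] [CompleteSpace H]

/-- `μ` is the Gaussian measure `N(m, C)` on `H`: a Borel probability measure all
of whose one-dimensional projections `x ↦ ⟪y, x⟫` are real Gaussians with mean
`⟪y, m⟫` and variance `⟪y, C y⟫`. -/
def IsGaussianMeasure [MeasurableSpace H] (μ : MeasureTheory.Measure H)
    (m : H) (C : H →L[ℝ] H) : Prop :=
  MeasureTheory.IsProbabilityMeasure μ ∧
    ∀ y : H, MeasureTheory.Measure.map (fun x => ⟪y, x⟫) μ =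
      ProbabilityTheory.gaussianReal ⟪y, m⟫ (Real.toNNReal ⟪y, C y⟫)

open MeasureTheory ProbabilityTheory
/-- A Hilbert space with a countable Hilbert basis is separable. -/
theorem HilbertBasis.separableSpace {E : Type*} [NormedAddCommGroup E] [InnerProductSpace ℝ E]
    (e : HilbertBasis ℕ ℝ E) : TopologicalSpace.SeparableSpace E := by
  rw [← TopologicalSpace.isSeparable_univ_iff]
  have h := ((Set.countable_range e).isSeparable.span (R := ℝ)).closure
  rwa [← Submodule.topologicalClosure_coe, e.dense_span] at h

/-- The fourth moment of a centered real Gaussian with variance `v` is `3 v ^ 2`. -/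
theorem integral_pow_four_gaussianReal (v : NNReal) :
    ∫ x, x ^ 4 ∂gaussianReal 0 v = 3 * (v : ℝ) ^ 2 := by
  have hstep (p p' : ℝ → ℝ) (hp : ∀ t, HasDerivAt p (p' t) t) :
      deriv (fun t => p t * Real.exp (v * t ^ 2 / 2)) =
        fun t => (p' t + v * t * p t) * Real.exp (v * t ^ 2 / 2) := by
    funext t
    have h2 : HasDerivAt (fun t : ℝ => (v : ℝ) * t ^ 2 / 2) (v * t) t := by
      convert! (((hasDerivAt_id t).pow 2).const_mul (v : ℝ)).div_const 2 using 1
      simp; ring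
    convert! ((hp t).mul h2.exp).deriv using 1
    ring
  have hm : mgf (fun x => x) (gaussianReal 0 v) =
      fun t => (fun _ => (1 : ℝ)) t * Real.exp (v * t ^ 2 / 2) := by
    simp [mgf_fun_id_gaussianReal]
  calc
    _ = iteratedDeriv 4 (mgf (fun x => x) (gaussianReal 0 v)) 0 := by
      rw [iteratedDeriv_mgf_zero] <;> simp
    _ = _ := by
      rw [hm, iteratedDeriv_eq_iterate]
      simp only [Function.iterate_succ, Function.iterate_zero, Function.comp_apply, id]
      rw [hstep _ (fun _ => 0) (fun t => hasDerivAt_const t 1),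
        hstep _ (fun _ => v) (fun t => by
          simpa using (hasDerivAt_id t).const_mul (v : ℝ)),
        hstep _ (fun t => 2 * (v : ℝ) ^ 2 * t) (fun t => by
          convert! ((hasDerivAt_id t).pow 2).const_mul ((v : ℝ) ^ 2) |>.const_add (v : ℝ) using 1
          · funext t; simp; ring
          · simp; ring),
        hstep _ (fun t => 3 * (v : ℝ) ^ 2 + 3 * (v : ℝ) ^ 3 * t ^ 2) (fun t => by
          convert! ((hasDerivAt_id t).const_mul (3 * (v : ℝ) ^ 2)).add
            (((hasDerivAt_id t).pow 3).const_mul ((v : ℝ) ^ 3)) using 1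
          · funext t; simp; ring
          · simp; ring)]
      simp

section CenteredGaussian

variable [MeasurableSpace H] [BorelSpace H] {ν : Measure H} {C : H →L[ℝ] H}

omit [CompleteSpace H] in
/-- Translating `N(m, C)` by `-m` yields `N(0, C)`. -/
theorem IsGaussianMeasure.map_sub_mean {μ : Measure H} {m : H} (h : IsGaussianMeasure μ m C) :
    IsGaussianMeasure (μ.map (fun x => x - m)) 0 C := by
  have := h.1
  refine ⟨Measure.isProbabilityMeasure_map (by fun_prop), fun y => ?_⟩
  rw [Measure.map_map (by fun_prop) (by fun_prop)]
  have : (fun x => ⟪y, x⟫) ∘ (fun x => x - m) = (fun r : ℝ => r - ⟪y, m⟫) ∘ (fun x => ⟪y, x⟫) := by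
    funext x
    simp [inner_sub_right]
  rw [this, ← Measure.map_map (by fun_prop) (by fun_prop), h.2 y, gaussianReal_map_sub_const]
  simp

theorem IsGaussianMeasure.isGaussian {m : H} (h : IsGaussianMeasure ν m C) : IsGaussian ν := by
  have := h.1
  refine isGaussian_of_map_eq_gaussianReal fun L => ?_
  have hL : ⇑L = fun x => ⟪(InnerProductSpace.toDual ℝ H).symm L, x⟫ := by
    funext x
    simp
  exact ⟨_, _, hL ▸ h.2 _⟩

theorem IsGaussianMeasure.integrable_norm_pow {m : H} [SecondCountableTopology H]
    (h : IsGaussianMeasure ν m C) (n : ℕ) : Integrable (fun x => ‖x‖ ^ n) ν := by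
  have := h.isGaussian
  exact (IsGaussian.memLp_id ν n (by simp)).integrable_norm_pow'

omit [CompleteSpace H] in
theorem IsGaussianMeasure.integral_inner_pow (h : IsGaussianMeasure ν 0 C) (y : H) (n : ℕ) :
    ∫ x, ⟪y, x⟫ ^ n ∂ν = ∫ r, r ^ n ∂gaussianReal 0 (Real.toNNReal ⟪y, C y⟫) := by
  have h2 := h.2 y
  rw [inner_zero_right] at h2
  rw [← h2, integral_map (by fun_prop) (by fun_prop)]

omit [CompleteSpace H] in
theorem IsGaussianMeasure.integral_inner_pow_two (h : IsGaussianMeasure ν 0 C)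
    (hC : C.IsPositive) (y : H) : ∫ x, ⟪y, x⟫ ^ 2 ∂ν = ⟪y, C y⟫ := by
  have hv := variance_fun_id_gaussianReal (μ := 0) (v := Real.toNNReal ⟪y, C y⟫)
  rw [variance_eq_integral measurable_id'.aemeasurable] at hv
  simp only [integral_id_gaussianReal, sub_zero] at hv
  rw [h.integral_inner_pow, hv, Real.coe_toNNReal _ (hC.inner_nonneg_right y)]

omit [CompleteSpace H] in
theorem IsGaussianMeasure.integral_inner_pow_four (h : IsGaussianMeasure ν 0 C)
    (hC : C.IsPositive) (y : H) : ∫ x, ⟪y, x⟫ ^ 4 ∂ν = 3 * ⟪y, C y⟫ ^ 2 := by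
  rw [h.integral_inner_pow, integral_pow_four_gaussianReal,
    Real.coe_toNNReal _ (hC.inner_nonneg_right y)]

variable [SecondCountableTopology H]

theorem IsGaussianMeasure.integral_inner_mul_inner (h : IsGaussianMeasure ν 0 C)
    (hC : C.IsPositive) (a b : H) : ∫ x, ⟪a, x⟫ * ⟪b, x⟫ ∂ν = ⟪a, C b⟫ := by
  have hi (y : H) : Integrable (fun x => ⟪y, x⟫ ^ 2) ν := by
    refine ((h.integrable_norm_pow 2).const_mul (‖y‖ ^ 2)).mono' (by fun_prop)
      (ae_of_all _ fun x => ?_)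
    rw [norm_pow, ← mul_pow]
    gcongr
    exact norm_inner_le_norm y x
  have hp : (fun x => ⟪a, x⟫ * ⟪b, x⟫) =
      fun x => (1 / 4) * (⟪a + b, x⟫ ^ 2 - ⟪a - b, x⟫ ^ 2) := by
    funext x
    simp only [inner_add_left, inner_sub_left]
    ring
  have hs : ⟪b, C a⟫ = ⟪a, C b⟫ := by rw [← hC.inner_left_eq_inner_right, real_inner_comm]
  rw [hp, integral_const_mul, integral_sub (hi _) (hi _), h.integral_inner_pow_two hC,
    h.integral_inner_pow_two hC]
  simp only [map_add, map_sub, inner_add_left, inner_sub_left, inner_add_right, inner_sub_right, hs]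
  ring

/-- Isserlis' formula for fourth moments. -/
theorem IsGaussianMeasure.integral_inner_mul_inner_mul_inner_mul_inner
    (h : IsGaussianMeasure ν 0 C) (hC : C.IsPositive) (a b c d : H) :
    ∫ x, ⟪a, x⟫ * ⟪b, x⟫ * (⟪c, x⟫ * ⟪d, x⟫) ∂ν =
      ⟪a, C b⟫ * ⟪c, C d⟫ + ⟪a, C c⟫ * ⟪b, C d⟫ + ⟪a, C d⟫ * ⟪b, C c⟫ := by
  have hi (y : H) : Integrable (fun x => ⟪y, x⟫ ^ 4) ν := by
    refine ((h.integrable_norm_pow 4).const_mul (‖y‖ ^ 4)).mono' (by fun_prop)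
      (ae_of_all _ fun x => ?_)
    rw [norm_pow, ← mul_pow]
    gcongr
    exact norm_inner_le_norm y x
  have hp : (fun x => ⟪a, x⟫ * ⟪b, x⟫ * (⟪c, x⟫ * ⟪d, x⟫)) = fun x => (1 / 192) *
      (((⟪a + b + c + d, x⟫ ^ 4 - ⟪a + b + c - d, x⟫ ^ 4)
        + (⟪a + b - c - d, x⟫ ^ 4 - ⟪a + b - c + d, x⟫ ^ 4))
        + ((⟪a - b + c - d, x⟫ ^ 4 - ⟪a - b + c + d, x⟫ ^ 4)
        + (⟪a - b - c + d, x⟫ ^ 4 - ⟪a - b - c - d, x⟫ ^ 4))) := by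
    funext x
    simp only [inner_add_left, inner_sub_left]
    ring
  have hs (u v : H) : ⟪u, C v⟫ = ⟪v, C u⟫ := by
    rw [← hC.inner_left_eq_inner_right, real_inner_comm]
  have hd (y z : H) : Integrable (fun x => ⟪y, x⟫ ^ 4 - ⟪z, x⟫ ^ 4) ν := (hi y).sub (hi z)
  have hd' (y z : H) : ∫ x, (⟪y, x⟫ ^ 4 - ⟪z, x⟫ ^ 4) ∂ν = 3 * ⟪y, C y⟫ ^ 2 - 3 * ⟪z, C z⟫ ^ 2 := by
    rw [integral_sub (hi y) (hi z), h.integral_inner_pow_four hC, h.integral_inner_pow_four hC]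
  have hdd (y z u w : H) :
      Integrable (fun x => (⟪y, x⟫ ^ 4 - ⟪z, x⟫ ^ 4) + (⟪u, x⟫ ^ 4 - ⟪w, x⟫ ^ 4)) ν :=
    (hd y z).add (hd u w)
  rw [hp, integral_const_mul, integral_add (hdd _ _ _ _) (hdd _ _ _ _),
    integral_add (hd _ _) (hd _ _), integral_add (hd _ _) (hd _ _), hd', hd', hd', hd']
  simp only [map_add, map_sub, inner_add_left, inner_sub_left, inner_add_right,
    inner_sub_right, hs b a, hs c a, hs d a, hs c b, hs d b, hs d c]
  ring

/-- Termwise integration of the expansion of a weighted quadratic form along a Hilbert basis. -/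
theorem HilbertBasis.hasSum_integral_inner_mul_inner (e : HilbertBasis ℕ ℝ H) (A : H →L[ℝ] H)
    {g : H → ℝ} (hg : AEStronglyMeasurable g ν) (hgi : Integrable (fun x => ‖x‖ ^ 2 * |g x|) ν) :
    HasSum (fun i => ∫ x, ⟪e i, x⟫ * ⟪A (e i), x⟫ * g x ∂ν) (∫ x, ⟪x, A x⟫ * g x ∂ν) := by
  have hsq (x : H) : HasSum (fun i => ⟪e i, x⟫ ^ 2) (‖x‖ ^ 2) := by
    simpa only [real_inner_comm x, ← sq, real_inner_self_eq_norm_sq] using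
      e.hasSum_inner_mul_inner x x
  have hb (x : H) : HasSum (fun i => (⟪e i, x⟫ ^ 2 + ⟪e i, adjoint A x⟫ ^ 2) * |g x|)
      ((‖x‖ ^ 2 + ‖adjoint A x‖ ^ 2) * |g x|) :=
    ((hsq x).add (hsq (adjoint A x))).mul_right _
  refine hasSum_integral_of_dominated_convergence
    (fun i x => (⟪e i, x⟫ ^ 2 + ⟪e i, adjoint A x⟫ ^ 2) * |g x|)
    (fun i => by fun_prop) (fun i => ae_of_all _ fun x => ?_)
    (ae_of_all _ fun x => (hb x).summable) ?_ (ae_of_all _ fun x => ?_)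
  · rw [norm_mul, Real.norm_eq_abs (g x), adjoint_inner_right, norm_mul, Real.norm_eq_abs,
      Real.norm_eq_abs]
    gcongr
    nlinarith [sq_nonneg (|⟪e i, x⟫| - |⟪A (e i), x⟫|), sq_abs ⟪e i, x⟫, sq_abs ⟪A (e i), x⟫,
      sq_nonneg ⟪e i, x⟫, sq_nonneg ⟪A (e i), x⟫]
  · simp only [(hb _).tsum_eq]
    refine (hgi.const_mul (1 + ‖adjoint A‖ ^ 2)).mono' (by fun_prop) (ae_of_all _ fun x => ?_)
    rw [norm_mul, Real.norm_eq_abs, Real.norm_eq_abs, abs_abs, abs_of_nonneg (by positivity),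
      ← mul_assoc, add_mul 1, one_mul, ← mul_pow]
    gcongr
    exact (adjoint A).le_opNorm x
  · have := (e.hasSum_inner_mul_inner x (adjoint A x)).mul_right (g x)
    simpa only [adjoint_inner_right, real_inner_comm x] using this

theorem IsGaussianMeasure.hasSum_inner_covariance_mul (h : IsGaussianMeasure ν 0 C)
    (hC : C.IsPositive) (e : HilbertBasis ℕ ℝ H) (A : H →L[ℝ] H) :
    HasSum (fun i => ⟪e i, (C * A) (e i)⟫) (∫ x, ⟪x, A x⟫ ∂ν) := by
  have := e.hasSum_integral_inner_mul_inner (ν := ν) A (g := fun _ => 1) (by fun_prop)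
    (by simpa using h.integrable_norm_pow 2)
  simpa [h.integral_inner_mul_inner hC] using this

theorem IsGaussianMeasure.hasSum_inner_covariance_mul_mul (h : IsGaussianMeasure ν 0 C)
    (hC : C.IsPositive) (e : HilbertBasis ℕ ℝ H) (A B : H →L[ℝ] H) :
    HasSum (fun i => ⟪e i, (C * (B + adjoint B) * C * A) (e i)⟫)
      (∫ x, ⟪x, A x⟫ * ⟪x, B x⟫ ∂ν - (∫ x, ⟪x, A x⟫ ∂ν) * ∫ x, ⟪x, B x⟫ ∂ν) := by
  have hi := h.integrable_norm_pow 4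
  have hinner (i : ℕ) : ∫ x, ⟪e i, x⟫ * ⟪A (e i), x⟫ * ⟪x, B x⟫ ∂ν =
      ⟪e i, (C * A) (e i)⟫ * (∫ x, ⟪x, B x⟫ ∂ν) +
        ⟪e i, (C * (B + adjoint B) * C * A) (e i)⟫ := by
    have hs := e.hasSum_integral_inner_mul_inner (ν := ν) B
      (g := fun x => ⟪e i, x⟫ * ⟪A (e i), x⟫) (by fun_prop) (by
        refine (hi.const_mul (‖e i‖ * ‖A (e i)‖)).mono' (by fun_prop) (ae_of_all _ fun x => ?_)
        rw [norm_mul, norm_pow, norm_norm, Real.norm_eq_abs, abs_abs, abs_mul]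
        calc _ ≤ ‖x‖ ^ 2 * ((‖e i‖ * ‖x‖) * (‖A (e i)‖ * ‖x‖)) := by
              gcongr <;> exact abs_real_inner_le_norm _ _
          _ = _ := by ring)
    simp only [h.integral_inner_mul_inner_mul_inner_mul_inner hC] at hs
    have h1 := (h.hasSum_inner_covariance_mul hC e B).mul_right ⟪e i, (C * A) (e i)⟫
    have h2 := e.hasSum_inner_mul_inner (C (e i)) (adjoint B (C (A (e i))))
    have h3 := e.hasSum_inner_mul_inner (C (A (e i))) (adjoint B (C (e i)))
    have h4 := (h1.add h2).add h3
    simp only [adjoint_inner_right, real_inner_comm (e _) (C _)] at h4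
    have h5 := hs.unique h4
    simp only [mul_comm (⟪e i, _⟫ * ⟪A (e i), _⟫)]
    have h6 : ⟪e i, (C * (B + adjoint B) * C * A) (e i)⟫ =
        ⟪B (C (e i)), C (A (e i))⟫ + ⟪B (C (A (e i))), C (e i)⟫ := by
      change ⟪e i, C (B (C (A (e i))) + adjoint B (C (A (e i))))⟫ = _
      rw [← hC.inner_left_eq_inner_right, inner_add_right, adjoint_inner_right,
        real_inner_comm (C (e i)), add_comm]
    rw [h5, h6]
    ring
  have hg := e.hasSum_integral_inner_mul_inner (ν := ν) A (g := fun x => ⟪x, B x⟫)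
    (by fun_prop) (by
      refine (hi.const_mul ‖B‖).mono' (by fun_prop) (ae_of_all _ fun x => ?_)
      rw [norm_mul, norm_pow, norm_norm, Real.norm_eq_abs, abs_abs]
      calc _ ≤ ‖x‖ ^ 2 * (‖x‖ * (‖B‖ * ‖x‖)) := by
            gcongr
            exact (abs_real_inner_le_norm _ _).trans (by gcongr; exact B.le_opNorm x)
        _ = _ := by ring)
  simp only [hinner] at hg
  simpa using hg.sub ((h.hasSum_inner_covariance_mul hC e A).mul_right (∫ x, ⟪x, B x⟫ ∂ν))

theorem IsGaussianMeasure.integral_inner_mul_inner_eq_traceAlong (h : IsGaussianMeasure ν 0 C)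
    (hC : C.IsPositive) (e : HilbertBasis ℕ ℝ H) (A B : H →L[ℝ] H) :
    ∫ x, ⟪x, A x⟫ * ⟪x, B x⟫ ∂ν =
      traceAlong e (C * A) * traceAlong e (C * B) +
        (1 / 2) * traceAlong e (C * (A + adjoint A) * C * (B + adjoint B)) := by
  have hsymm (x : H) : ⟪x, adjoint B x⟫ = ⟪x, B x⟫ := by
    rw [adjoint_inner_right, real_inner_comm]
  have h1 := h.hasSum_inner_covariance_mul_mul hC e B A
  have h2 := h.hasSum_inner_covariance_mul_mul hC e (adjoint B) A
  simp only [hsymm] at h2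
  have h3 := h1.add h2
  simp only [← inner_add_right, ← add_apply, ← mul_add] at h3
  have h4 : traceAlong e (C * (A + adjoint A) * C * (B + adjoint B)) = _ := h3.tsum_eq
  have hA : traceAlong e (C * A) = _ := (h.hasSum_inner_covariance_mul hC e A).tsum_eq
  have hB : traceAlong e (C * B) = _ := (h.hasSum_inner_covariance_mul hC e B).tsum_eq
  rw [h4, hA, hB]
  simp only [mul_comm ⟪_, B _⟫]
  ring

end CenteredGaussian

omit [CompleteSpace H] in
theorem traceAlong_smul (e : HilbertBasis ℕ ℝ H) (r : ℝ) (A : H →L[ℝ] H) :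
    traceAlong e (r • A) = r * traceAlong e A := by
  simp [traceAlong, inner_smul_right, tsum_mul_left]

/-- second moments of quadratic forms under a Gaussian measure
`N(m,C)` on `H`: for all bounded `A, B`,
`∫ ⟪x-m, A(x-m)⟫⟪x-m, B(x-m)⟫ dN(m,C) = tr(CA)tr(CB) + (1/2)tr(C(A+A*)C(B+B*))`;
for self-adjoint `A, B` this equals `tr(CA)tr(CB) + 2tr(CACB)`, and in particular
`∫ ⟪x-m, A(x-m)⟫² dN(m,C) = (tr(CA))² + 2tr((CA)²)` for self-adjoint `A`. -/
theorem gaussian_quadratic_second_moment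
    [MeasurableSpace H] [BorelSpace H]
    (e : HilbertBasis ℕ ℝ H)
    (m : H) (C : H →L[ℝ] H)
    (hCpos : C.IsPositive)
    (hCtr : Summable fun n => ⟪e n, C (e n)⟫)
    (μ : MeasureTheory.Measure H)
    (hμ : IsGaussianMeasure μ m C)
    (A B : H →L[ℝ] H) :
    (∫ x, ⟪x - m, A (x - m)⟫ * ⟪x - m, B (x - m)⟫ ∂μ =
      traceAlong e (C * A) * traceAlong e (C * B) +
        (1 / 2) * traceAlong e (C * (A + adjoint A) * C * (B + adjoint B))) ∧
    (IsSelfAdjoint A → IsSelfAdjoint B →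
      ∫ x, ⟪x - m, A (x - m)⟫ * ⟪x - m, B (x - m)⟫ ∂μ =
        traceAlong e (C * A) * traceAlong e (C * B) +
          2 * traceAlong e (C * A * C * B)) ∧
    (IsSelfAdjoint A →
      ∫ x, ⟪x - m, A (x - m)⟫ ^ 2 ∂μ =
        traceAlong e (C * A) ^ 2 + 2 * traceAlong e (C * A * C * A)) := by
  have := e.separableSpace
  have : SecondCountableTopology H := UniformSpace.secondCountable_of_separable H
  have hgen (A B : H →L[ℝ] H) : ∫ x, ⟪x - m, A (x - m)⟫ * ⟪x - m, B (x - m)⟫ ∂μ =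
      traceAlong e (C * A) * traceAlong e (C * B) +
        (1 / 2) * traceAlong e (C * (A + adjoint A) * C * (B + adjoint B)) := by
    rw [← hμ.map_sub_mean.integral_inner_mul_inner_eq_traceAlong hCpos e A B,
      integral_map (by fun_prop) (by fun_prop)]
  have hsa (A B : H →L[ℝ] H) (hA : IsSelfAdjoint A) (hB : IsSelfAdjoint B) :
      ∫ x, ⟪x - m, A (x - m)⟫ * ⟪x - m, B (x - m)⟫ ∂μ =
        traceAlong e (C * A) * traceAlong e (C * B) + 2 * traceAlong e (C * A * C * B) := by
    have h4 : C * (A + adjoint A) * C * (B + adjoint B) = (4 : ℝ) • (C * A * C * B) := by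
      rw [hA.adjoint_eq, hB.adjoint_eq, ← two_smul ℝ A, ← two_smul ℝ B]
      simp only [mul_smul_comm, smul_mul_assoc, smul_smul]
      norm_num
    rw [hgen, h4, traceAlong_smul]
    ring
  refine ⟨hgen A B, hsa A B, fun hA => ?_⟩
  simp only [sq]
  exact hsa A A hA hA
end
end
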